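/- arXiv:1011.3770 — 2 statements merged into one kernel-verified Lean document; each statement's English description precedes it below -/
import Mathlib

section
/- There exist constants γ > 0, c > 0 and d₀ such that the following holds for every (n,d,β)-expander G with d ≥ d₀ and β ≤ 1/10. Let t = ⌊(log n)/(4·log d)⌋ and ℓ = ⌈γ·(log n)/(log d)⌉, and let V be partitioned into ℓ blocks of equal size. If q₁ and q₂ are two independent t-step random walks on G, then with probability at least 1 − exp(−c·(log n)/(log d)), each of q₁ and q₂ visits vertices in at least 3ℓ/4 of the ℓ blocks. -/
open scoped Classical

noncomputable section

/-- A finitely supported probability distribution on a type `A`. -/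
structure FinDist (A : Type*) where
  w : A →₀ ℝ
  nonneg : ∀ a, 0 ≤ w a
  total : ∑ a ∈ w.support, w a = 1

namespace FinDist

variable {A : Type*}

/-- The (finite) support of a finitely supported distribution. -/
def support (D : FinDist A) : Finset A := D.w.support

/-- The probability of an event under a finitely supported distribution. -/
def pr (D : FinDist A) (p : A → Prop) : ℝ :=
  ∑ a ∈ D.support.filter p, D.w a

/-- The expectation of a real-valued function under a finitely supported distribution. -/
def exp (D : FinDist A) (f : A → ℝ) : ℝ :=
  ∑ a ∈ D.support, D.w a * f a

end FinDist

/-- `c` is a metric on `V`. -/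
structure IsMetric {V : Type*} (c : V → V → ℝ) : Prop where
  refl : ∀ x, c x x = 0
  pos : ∀ x y, x ≠ y → 0 < c x y
  symm : ∀ x y, c x y = c y x
  triangle : ∀ x y z, c x z ≤ c x y + c y z

/-- The cost of an unordered pair of vertices (agrees with `c` when `c` is symmetric). -/
def sym2Cost {V : Type*} (c : V → V → ℝ) : Sym2 V → ℝ :=
  Sym2.lift ⟨fun x y => (c x y + c y x) / 2, fun x y => by dsimp; ring⟩

/-- A path (sequence of distinct vertices) from `v` to `r`. -/
def RootPath (V : Type*) (v r : V) : Type _ :=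
  {l : List V // l.Nodup ∧ l.head? = some v ∧ l.getLast? = some r}

/-- A collection of vertex-to-root paths, one for each vertex. -/
def PathSystem (V : Type*) (r : V) : Type _ := ∀ v : V, RootPath V v r

/-- The set of (unordered) edges of a list of vertices: pairs of consecutive entries. -/
def listEdges {V : Type*} [DecidableEq V] (l : List V) : Finset (Sym2 V) :=
  ((l.zip l.tail).map (fun p => s(p.1, p.2))).toFinset

/-- `c(P[X])`: the total cost of the union of the edges of the paths `p_v`, `v ∈ X`. -/
def pathSystemCost {V : Type*} [DecidableEq V] (c : V → V → ℝ) {r : V}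
    (P : PathSystem V r) (X : Finset V) : ℝ :=
  ∑ e ∈ X.biUnion (fun v => listEdges (P v).1), sym2Cost c e

/-- The set of costs of Steiner trees for `X ∪ {r}`: trees `T` on vertex sets `W`
with `X ∪ {r} ⊆ W ⊆ V`. -/
def steinerCosts {V : Type*} [Fintype V] [DecidableEq V] (c : V → V → ℝ) (r : V)
    (X : Finset V) : Set ℝ :=
  {y | ∃ (W : Finset V) (T : SimpleGraph V),
    insert r X ⊆ W ∧
    (∀ e ∈ T.edgeSet, ∀ v ∈ e, v ∈ W) ∧
    (SimpleGraph.induce (↑W) T).IsTree ∧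
    y = ∑ e ∈ Finset.univ.filter (fun e : Sym2 V => e ∈ T.edgeSet), sym2Cost c e}

/-- `opt_ST(X)`: the optimal Steiner tree cost for `X ∪ {r}`. -/
def optST {V : Type*} [Fintype V] [DecidableEq V] (c : V → V → ℝ) (r : V)
    (X : Finset V) : ℝ :=
  sInf (steinerCosts c r X)

/-- The cost of the closed tour that starts at `r`, visits the vertices of `l` in order,
and returns to `r`. -/
def tourCost {V : Type*} (c : V → V → ℝ) (r : V) (l : List V) : ℝ :=
  ((((r :: l) ++ [r]).zip (((r :: l) ++ [r]).tail)).map (fun p => c p.1 p.2)).sum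

/-- `σ_X`: the ordering that the tour `σ` induces on the elements of `X`. -/
def permInduced {n : ℕ} (σ : Equiv.Perm (Fin n)) (X : Finset (Fin n)) : List (Fin n) :=
  ((List.finRange n).map σ).filter (fun v => decide (v ∈ X))

/-- `opt_TSP(X)`: the minimum closed-tour cost through `X ∪ {r}`. -/
def optTSP {V : Type*} [DecidableEq V] (c : V → V → ℝ) (r : V) (X : Finset V) : ℝ :=
  sInf {y | ∃ l : List V, l.Nodup ∧ l.toFinset = X ∧ y = tourCost c r l}

/-- An `(n,d,β)`-expander: a `d`-regular graph on `n` vertices such that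
`|xᵀAx| ≤ β·d·xᵀx` for every `x` orthogonal to the all-ones vector. -/
def IsExpander (n d : ℕ) (β : ℝ) (G : SimpleGraph (Fin n)) : Prop :=
  (∀ v : Fin n, (Finset.univ.filter (fun w => G.Adj v w)).card = d) ∧
  ∀ x : Fin n → ℝ, (∑ v, x v = 0) →
    |∑ v, ∑ w, (if G.Adj v w then x v * x w else 0)| ≤ β * d * ∑ v, (x v) ^ 2

/-- `u : Fin (t+1) → Fin n` encodes a `t`-step walk in `G`. -/
def IsWalkFun {n : ℕ} (G : SimpleGraph (Fin n)) {t : ℕ} (u : Fin (t + 1) → Fin n) : Prop :=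
  ∀ i : Fin t, G.Adj (u i.castSucc) (u i.succ)

/-- The probability that a `t`-step random walk on a `d`-regular graph `G`
(uniform start, uniform steps; each walk has probability `1/(n·dᵗ)`) satisfies `p`. -/
def walkPr {n : ℕ} (G : SimpleGraph (Fin n)) (d t : ℕ)
    (p : (Fin (t + 1) → Fin n) → Prop) : ℝ :=
  ((Finset.univ.filter
      (fun u : Fin (t + 1) → Fin n => IsWalkFun G u ∧ p u)).card : ℝ) / (n * d ^ t)

/-- The probability that two independent `t`-step random walks on `G` satisfy `p`. -/
def walkPairPr {n : ℕ} (G : SimpleGraph (Fin n)) (d t : ℕ)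
    (p : (Fin (t + 1) → Fin n) → (Fin (t + 1) → Fin n) → Prop) : ℝ :=
  ((Finset.univ.filter
      (fun q : (Fin (t + 1) → Fin n) × (Fin (t + 1) → Fin n) =>
        IsWalkFun G q.1 ∧ IsWalkFun G q.2 ∧ p q.1 q.2)).card : ℝ) / (n * d ^ t) ^ 2

/-- The edge set of the path from `u` to `v` in `T` (the unique such path when `T`
is a tree); empty if `u` and `v` are not connected in `T`. -/
def treePathEdges {V : Type*} [DecidableEq V] (T : SimpleGraph V) (u v : V) :
    Finset (Sym2 V) :=
  if h : T.Reachable u v then (h.some.toPath : T.Path u v).1.edges.toFinset else ∅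

/-- `c_T(u,v)`: the cost of the unique `u`–`v` path in the tree `T`. -/
def treePathCost {V : Type*} [DecidableEq V] (c : V → V → ℝ) (T : SimpleGraph V)
    (u v : V) : ℝ :=
  ∑ e ∈ treePathEdges T u v, sym2Cost c e

/-- `c(T[X])`: the cost of the minimal subtree of the tree `T` containing `X ∪ {r}`. -/
def subtreeCost {V : Type*} [DecidableEq V] (c : V → V → ℝ) (T : SimpleGraph V)
    (r : V) (X : Finset V) : ℝ :=
  ∑ e ∈ (insert r X).biUnion (fun v => treePathEdges T v r), sym2Cost c e

end

/-- The number of `t`-step walks of `G` that start at `v` and stay inside `S`. -/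
noncomputable def stayCount {n : ℕ} (G : SimpleGraph (Fin n)) (S : Finset (Fin n)) :
    ℕ → Fin n → ℝ
  | 0, v => if v ∈ S then 1 else 0
  | t + 1, v => if v ∈ S then ∑ w, if G.Adj v w then stayCount G S t w else 0 else 0

theorem isWalkFun_cons {n t : ℕ} (G : SimpleGraph (Fin n)) (v : Fin n)
    (u : Fin (t + 1) → Fin n) :
    IsWalkFun G (Fin.cons v u : Fin (t + 2) → Fin n) ↔ G.Adj v (u 0) ∧ IsWalkFun G u := by
  unfold IsWalkFun
  rw [Fin.forall_fin_succ]
  simp [Fin.castSucc_succ]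

theorem sum_fin_cons {n t : ℕ} (F : (Fin (t + 1) → Fin n) → ℝ) :
    ∑ u, F u = ∑ v, ∑ u : Fin t → Fin n, F (Fin.cons v u) := by
  rw [← (Fin.consEquiv (fun _ : Fin (t + 1) => Fin n)).sum_comp, Fintype.sum_prod_type]
  rfl

theorem stayCount_eq {n : ℕ} (G : SimpleGraph (Fin n)) (S : Finset (Fin n)) (t : ℕ)
    (v : Fin n) :
    stayCount G S t v = ∑ u : Fin t → Fin n,
      if IsWalkFun G (Fin.cons v u : Fin (t + 1) → Fin n) ∧
        ∀ i, (Fin.cons v u : Fin (t + 1) → Fin n) i ∈ S then 1 else 0 := by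
  induction t generalizing v with
  | zero => simp [stayCount, IsWalkFun]
  | succ t ih =>
    rw [sum_fin_cons]
    simp only [stayCount, ih]
    simp only [isWalkFun_cons G v, Fin.forall_fin_succ (n := t + 1),
      Fin.cons_zero, Fin.cons_succ]
    by_cases hv : v ∈ S
    · simp only [hv, if_true, true_and]
      refine Finset.sum_congr rfl fun w _ => ?_
      by_cases hw : G.Adj v w <;> simp [hw]
    · simp [hv]

theorem card_staying_walks {n : ℕ} (G : SimpleGraph (Fin n)) (S : Finset (Fin n)) (t : ℕ) :
    ((Finset.univ.filter (fun u : Fin (t + 1) → Fin n =>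
      IsWalkFun G u ∧ ∀ i, u i ∈ S)).card : ℝ) = ∑ v, stayCount G S t v := by
  simp only [stayCount_eq]
  rw [← sum_fin_cons (fun u => if IsWalkFun G u ∧ ∀ i, u i ∈ S then (1 : ℝ) else 0)]
  simp

theorem stayCount_univ {n d : ℕ} (G : SimpleGraph (Fin n))
    (hreg : ∀ v : Fin n, (Finset.univ.filter (fun w => G.Adj v w)).card = d) (t : ℕ)
    (v : Fin n) : stayCount G Finset.univ t v = (d : ℝ) ^ t := by
  induction t generalizing v with
  | zero => simp [stayCount]
  | succ t ih =>
    simp only [stayCount, ih, Finset.mem_univ, if_true]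
    rw [← Finset.sum_filter, Finset.sum_const, hreg, nsmul_eq_mul, pow_succ']

theorem card_walks {n d : ℕ} (G : SimpleGraph (Fin n))
    (hreg : ∀ v : Fin n, (Finset.univ.filter (fun w => G.Adj v w)).card = d) (t : ℕ) :
    ((Finset.univ.filter (fun u : Fin (t + 1) → Fin n => IsWalkFun G u)).card : ℝ)
      = n * (d : ℝ) ^ t := by
  have h := card_staying_walks G Finset.univ t
  simpa [stayCount_univ G hreg] using h

/-- A symmetric matrix whose quadratic form is bounded by `C` in absolute value has
`ℓ²`-operator norm at most `C`. -/
theorem sum_sq_mulVec_le_of_abs_quadForm_le {ι : Type*} [Fintype ι] (B : ι → ι → ℝ)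
    (hB : ∀ v w, B v w = B w v) {C : ℝ} (hC : 0 < C)
    (hq : ∀ x : ι → ℝ, |∑ v, ∑ w, B v w * x v * x w| ≤ C * ∑ v, x v ^ 2) (x : ι → ℝ) :
    ∑ v, (∑ w, B v w * x w) ^ 2 ≤ C ^ 2 * ∑ v, x v ^ 2 := by
  set y : ι → ℝ := fun v => ∑ w, B v w * x w with hy
  have hcross : ∀ z : ι → ℝ, ∑ v, ∑ w, B v w * z v * x w = ∑ v, z v * y v := by
    intro z
    simp only [hy, Finset.mul_sum]
    exact Finset.sum_congr rfl fun v _ => Finset.sum_congr rfl fun w _ => by ring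
  have hcross' : ∀ z : ι → ℝ, ∑ v, ∑ w, B v w * x v * z w = ∑ v, z v * y v := by
    intro z
    rw [← hcross z, Finset.sum_comm]
    exact Finset.sum_congr rfl fun v _ => Finset.sum_congr rfl fun w _ => by
      rw [hB w v]; ring
  have hp := (abs_le.1 (hq fun v => C * x v + y v)).2
  have hm := (abs_le.1 (hq fun v => C * x v - y v)).1
  have e1 : ∑ v, ∑ w, B v w * (C * x v + y v) * (C * x w + y w)
      - ∑ v, ∑ w, B v w * (C * x v - y v) * (C * x w - y w)
      = 4 * C * ∑ v, y v ^ 2 := by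
    have : ∑ v, ∑ w, B v w * (C * x v + y v) * (C * x w + y w)
        - ∑ v, ∑ w, B v w * (C * x v - y v) * (C * x w - y w)
        = 2 * C * ∑ v, ∑ w, B v w * y v * x w + 2 * C * ∑ v, ∑ w, B v w * x v * y w := by
      simp only [Finset.mul_sum, ← Finset.sum_sub_distrib, ← Finset.sum_add_distrib]
      exact Finset.sum_congr rfl fun v _ => Finset.sum_congr rfl fun w _ => by ring
    rw [this, hcross, hcross']
    simp only [← sq]
    ring
  have e2 : ∑ v, (C * x v + y v) ^ 2 + ∑ v, (C * x v - y v) ^ 2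
      = 2 * C ^ 2 * ∑ v, x v ^ 2 + 2 * ∑ v, y v ^ 2 := by
    simp only [Finset.mul_sum, ← Finset.sum_add_distrib]
    exact Finset.sum_congr rfl fun v _ => by ring
  have h3 : 4 * C * ∑ v, y v ^ 2
      ≤ C * (2 * C ^ 2 * ∑ v, x v ^ 2 + 2 * ∑ v, y v ^ 2) := by
    rw [← e1, ← e2]; linarith
  have h4 : C * (2 * ∑ v, y v ^ 2) ≤ C * (2 * (C ^ 2 * ∑ v, x v ^ 2)) := by linarith
  have := le_of_mul_le_mul_left h4 hC
  linarith

/-- In a regular graph, the adjacency form splits along the all-ones vector. -/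
theorem adjForm_const_add {n d : ℕ} (G : SimpleGraph (Fin n))
    (hreg : ∀ v : Fin n, (Finset.univ.filter (fun w => G.Adj v w)).card = d)
    (a : ℝ) (x : Fin n → ℝ) (hx : ∑ v, x v = 0) :
    ∑ v, ∑ w, (if G.Adj v w then (a + x v) * (a + x w) else 0)
      = a ^ 2 * d * n + ∑ v, ∑ w, (if G.Adj v w then x v * x w else 0) := by
  have hdeg : ∀ v, ∑ w, (if G.Adj v w then (1 : ℝ) else 0) = d := by
    intro v; rw [Finset.sum_boole, hreg]
  have h1 : ∑ v, ∑ w, (if G.Adj v w then x v else 0) = 0 := by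
    have : ∀ v, ∑ w, (if G.Adj v w then x v else 0) = d * x v := by
      intro v; rw [← hdeg v, Finset.sum_mul]; simp
    simp only [this, ← Finset.mul_sum, hx, mul_zero]
  have h2 : ∑ v, ∑ w, (if G.Adj v w then x w else 0) = 0 := by
    rw [Finset.sum_comm]
    refine Eq.trans ?_ h1
    exact Finset.sum_congr rfl fun v _ => Finset.sum_congr rfl fun w _ => by
      simp only [G.adj_comm w v]
  have h0 : ∑ v : Fin n, ∑ w, (if G.Adj v w then (1 : ℝ) else 0) = d * n := by
    simp only [hdeg]; simp [mul_comm]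
  have key : ∑ v, ∑ w, (if G.Adj v w then (a + x v) * (a + x w) else 0)
      = a ^ 2 * ∑ v : Fin n, ∑ w, (if G.Adj v w then (1 : ℝ) else 0)
        + a * ∑ v, ∑ w, (if G.Adj v w then x v else 0)
        + a * ∑ v, ∑ w, (if G.Adj v w then x w else 0)
        + ∑ v, ∑ w, (if G.Adj v w then x v * x w else 0) := by
    simp only [Finset.mul_sum, ← Finset.sum_add_distrib]
    refine Finset.sum_congr rfl fun v _ => Finset.sum_congr rfl fun w _ => ?_
    split_ifs <;> ring
  rw [key, h0, h1, h2]; ring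

theorem IsExpander.abs_adjForm_le {n d : ℕ} {β : ℝ} {G : SimpleGraph (Fin n)}
    (hG : IsExpander n d β G) (hβ : β ≤ 1 / 10) (S : Finset (Fin n))
    (hS : 4 * S.card ≤ 3 * n) (y : Fin n → ℝ) (hy : ∀ v, v ∉ S → y v = 0) :
    |∑ v, ∑ w, (if G.Adj v w then y v * y w else 0)| ≤ 31 / 40 * d * ∑ v, y v ^ 2 := by
  rcases Nat.eq_zero_or_pos n with rfl | hn
  · simp
  have hn' : (0 : ℝ) < n := by exact_mod_cast hn
  set a : ℝ := (∑ v, y v) / n with ha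
  have hna : n * a = ∑ v, y v := by rw [ha]; field_simp
  set x : Fin n → ℝ := fun v => y v - a with hxdef
  have hx : ∑ v, x v = 0 := by
    simp only [hxdef, Finset.sum_sub_distrib]
    simp [hna]
  have hyx : ∀ v, y v = a + x v := fun v => by simp [hxdef]
  have hxsq : ∑ v, x v ^ 2 = ∑ v, y v ^ 2 - n * a ^ 2 := by
    have : ∑ v, x v ^ 2 = ∑ v, y v ^ 2 - 2 * a * ∑ v, y v + n * a ^ 2 := by
      simp only [hxdef, sub_sq, Finset.sum_sub_distrib, Finset.sum_add_distrib, Finset.mul_sum]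
      congr 1
      · congr 1
        exact Finset.sum_congr rfl fun v _ => by ring
      · simp
    rw [this, ← hna]; ring
  have hcs : n * a ^ 2 ≤ 3 / 4 * ∑ v, y v ^ 2 := by
    have h1 : ∑ v, y v = ∑ v ∈ S, y v :=
      (Finset.sum_subset (Finset.subset_univ S) fun v _ hv => hy v hv).symm
    have h2 : ∑ v, y v ^ 2 = ∑ v ∈ S, y v ^ 2 :=
      (Finset.sum_subset (Finset.subset_univ S) fun v _ hv => by simp [hy v hv]).symm
    have h3 : (∑ v ∈ S, y v) ^ 2 ≤ S.card * ∑ v ∈ S, y v ^ 2 := sq_sum_le_card_mul_sum_sq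
    have h4 : (S.card : ℝ) ≤ 3 / 4 * n := by
      have : (4 : ℝ) * S.card ≤ 3 * n := by exact_mod_cast hS
      linarith
    rw [← h1, ← h2, ← hna] at h3
    have h5 : (0 : ℝ) ≤ ∑ v, y v ^ 2 := Finset.sum_nonneg fun v _ => sq_nonneg _
    have h6 := mul_le_mul_of_nonneg_right h4 h5
    refine le_of_mul_le_mul_left ?_ hn'
    linarith
  have hxA := hG.2 x hx
  have hx0 : (0 : ℝ) ≤ d * ∑ v, x v ^ 2 :=
    mul_nonneg (Nat.cast_nonneg _) (Finset.sum_nonneg fun v _ => sq_nonneg _)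
  have hxA' : |∑ v, ∑ w, (if G.Adj v w then x v * x w else 0)|
      ≤ 1 / 10 * (d * ∑ v, x v ^ 2) := by
    refine hxA.trans ?_
    rw [mul_assoc]
    exact mul_le_mul_of_nonneg_right hβ hx0
  have hsplit := adjForm_const_add G hG.1 a x hx
  simp only [← hyx] at hsplit
  rw [hsplit]
  refine (abs_add_le _ _).trans ?_
  rw [abs_of_nonneg (by positivity : (0 : ℝ) ≤ a ^ 2 * d * n)]
  have h7 := mul_le_mul_of_nonneg_left hcs (Nat.cast_nonneg d : (0 : ℝ) ≤ d)
  rw [hxsq] at hxA'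
  linarith

theorem IsExpander.sum_sq_stayCount_le {n d : ℕ} {β : ℝ} {G : SimpleGraph (Fin n)}
    (hG : IsExpander n d β G) (hβ : β ≤ 1 / 10) (hd : 0 < d) (S : Finset (Fin n))
    (hS : 4 * S.card ≤ 3 * n) (t : ℕ) :
    ∑ v, stayCount G S t v ^ 2 ≤ ((31 / 40 * d : ℝ) ^ t) ^ 2 * n := by
  have hd' : (0 : ℝ) < d := by exact_mod_cast hd
  induction t with
  | zero =>
    calc ∑ v, stayCount G S 0 v ^ 2 ≤ ∑ _v : Fin n, (1 : ℝ) :=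
          Finset.sum_le_sum fun v _ => by simp only [stayCount]; split_ifs <;> norm_num
      _ = _ := by simp
  | succ t ih =>
    set B : Fin n → Fin n → ℝ := fun v w => if v ∈ S ∧ w ∈ S ∧ G.Adj v w then 1 else 0 with hBdef
    have hB : ∀ v w, B v w = B w v := fun v w => by
      simp only [hBdef, G.adj_comm v w]
      congr 1
      exact propext ⟨fun h => ⟨h.2.1, h.1, h.2.2⟩, fun h => ⟨h.2.1, h.1, h.2.2⟩⟩
    have hq : ∀ x : Fin n → ℝ,
        |∑ v, ∑ w, B v w * x v * x w| ≤ 31 / 40 * d * ∑ v, x v ^ 2 := by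
      intro x
      have h := hG.abs_adjForm_le hβ S hS (fun v => if v ∈ S then x v else 0)
        (fun v hv => by simp [hv])
      have e : ∑ v, ∑ w, B v w * x v * x w = ∑ v, ∑ w, (if G.Adj v w then
          (if v ∈ S then x v else 0) * (if w ∈ S then x w else 0) else 0) := by
        refine Finset.sum_congr rfl fun v _ => Finset.sum_congr rfl fun w _ => ?_
        by_cases h1 : v ∈ S <;> by_cases h2 : w ∈ S <;> by_cases h3 : G.Adj v w <;>
          simp [hBdef, h1, h2, h3]
      rw [e]
      refine h.trans (mul_le_mul_of_nonneg_left ?_ (by positivity))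
      refine Finset.sum_le_sum fun v _ => ?_
      split_ifs
      · exact le_rfl
      · simpa using sq_nonneg (x v)
    have hstep : ∀ v, stayCount G S (t + 1) v = ∑ w, B v w * stayCount G S t w := by
      intro v
      have hout : ∀ w, w ∉ S → stayCount G S t w = 0 := by
        intro w hw; cases t <;> simp [stayCount, hw]
      by_cases hv : v ∈ S
      · simp only [stayCount, hv, if_true]
        refine Finset.sum_congr rfl fun w _ => ?_
        by_cases hw : w ∈ S <;> by_cases h3 : G.Adj v w <;> simp [hBdef, hv, hw, h3, hout]
      · simp [stayCount, hv, hBdef]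
    simp only [hstep]
    refine (sum_sq_mulVec_le_of_abs_quadForm_le B hB (by positivity) hq _).trans ?_
    calc (31 / 40 * d : ℝ) ^ 2 * ∑ v, stayCount G S t v ^ 2
        ≤ (31 / 40 * d : ℝ) ^ 2 * (((31 / 40 * d : ℝ) ^ t) ^ 2 * n) := by gcongr
      _ = _ := by ring

theorem IsExpander.card_staying_walks_le {n d : ℕ} {β : ℝ} {G : SimpleGraph (Fin n)}
    (hG : IsExpander n d β G) (hβ : β ≤ 1 / 10) (hd : 0 < d) (S : Finset (Fin n))
    (hS : 4 * S.card ≤ 3 * n) (t : ℕ) :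
    ((Finset.univ.filter (fun u : Fin (t + 1) → Fin n =>
      IsWalkFun G u ∧ ∀ i, u i ∈ S)).card : ℝ) ≤ n * (31 / 40 * d : ℝ) ^ t := by
  rw [card_staying_walks]
  refine abs_le_of_sq_le_sq' ?_ (by positivity) |>.2
  have h1 : (∑ v, stayCount G S t v) ^ 2 ≤ n * ∑ v, stayCount G S t v ^ 2 := by
    simpa using sq_sum_le_card_mul_sum_sq (s := Finset.univ) (f := stayCount G S t)
  refine h1.trans ?_
  calc (n : ℝ) * ∑ v, stayCount G S t v ^ 2
      ≤ n * (((31 / 40 * d : ℝ) ^ t) ^ 2 * n) := by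
        gcongr; exact hG.sum_sq_stayCount_le hβ hd S hS t
    _ = _ := by ring

theorem card_preimage_blocks {n ℓ : ℕ} (blk : Fin n → Fin ℓ)
    (heq : ∀ j j' : Fin ℓ, (Finset.univ.filter (fun v => blk v = j)).card =
      (Finset.univ.filter (fun v => blk v = j')).card)
    (J : Finset (Fin ℓ)) (hJ : 4 * J.card ≤ 3 * ℓ) :
    4 * (Finset.univ.filter (fun v => blk v ∈ J)).card ≤ 3 * n := by
  rcases J.eq_empty_or_nonempty with rfl | ⟨j₀, _⟩
  · simp
  set m := (Finset.univ.filter (fun v => blk v = j₀)).card with hm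
  have hfib : ∀ K : Finset (Fin ℓ),
      (Finset.univ.filter (fun v => blk v ∈ K)).card = K.card * m := by
    intro K
    rw [Finset.card_eq_sum_card_fiberwise (f := blk) (t := K) (fun v hv => by simpa using hv)]
    rw [Finset.sum_const_nat (m := m)]
    intro j hj
    rw [hm, heq j₀ j]
    congr 1
    ext v
    simp only [Finset.mem_filter, Finset.mem_univ, true_and]
    exact ⟨fun h => h.2, fun h => ⟨h ▸ hj, h⟩⟩
  have htot : n = ℓ * m := by simpa using hfib Finset.univ
  rw [hfib J]
  calc 4 * (J.card * m) = (4 * J.card) * m := by ring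
    _ ≤ (3 * ℓ) * m := by gcongr
    _ = 3 * (ℓ * m) := by ring
    _ = 3 * n := by rw [← htot]

theorem IsExpander.card_walks_few_blocks_le {n d ℓ : ℕ} {β : ℝ} {G : SimpleGraph (Fin n)}
    (hG : IsExpander n d β G) (hβ : β ≤ 1 / 10) (hd : 0 < d) (blk : Fin n → Fin ℓ)
    (heq : ∀ j j' : Fin ℓ, (Finset.univ.filter (fun v => blk v = j)).card =
      (Finset.univ.filter (fun v => blk v = j')).card) (t : ℕ) :
    ((Finset.univ.filter (fun u : Fin (t + 1) → Fin n => IsWalkFun G u ∧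
      ¬ ((Finset.univ.image (fun i => blk (u i))).card : ℝ) ≥ 3 * ℓ / 4)).card : ℝ)
      ≤ 2 ^ ℓ * (n * (31 / 40 * d : ℝ) ^ t) := by
  set 𝒥 := (Finset.univ : Finset (Finset (Fin ℓ))).filter (fun J => 4 * J.card ≤ 3 * ℓ)
  have hsub : (Finset.univ.filter (fun u : Fin (t + 1) → Fin n => IsWalkFun G u ∧
      ¬ ((Finset.univ.image (fun i => blk (u i))).card : ℝ) ≥ 3 * ℓ / 4)) ⊆
      𝒥.biUnion fun J => Finset.univ.filter (fun u : Fin (t + 1) → Fin n =>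
        IsWalkFun G u ∧ ∀ i, u i ∈ Finset.univ.filter (fun v => blk v ∈ J)) := by
    intro u hu
    simp only [Finset.mem_filter, Finset.mem_univ, true_and, ge_iff_le, not_le] at hu
    refine Finset.mem_biUnion.2 ⟨Finset.univ.image (fun i => blk (u i)), ?_, ?_⟩
    · have h := hu.2
      have h' : (4 * (Finset.univ.image (fun i => blk (u i))).card : ℝ) ≤ 3 * ℓ := by linarith
      exact Finset.mem_filter.2 ⟨Finset.mem_univ _, by exact_mod_cast h'⟩
    · simp [hu.1]
  have h1 := (Finset.card_le_card hsub).trans Finset.card_biUnion_le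
  have h2 : ((Finset.univ.filter (fun u : Fin (t + 1) → Fin n => IsWalkFun G u ∧
      ¬ ((Finset.univ.image (fun i => blk (u i))).card : ℝ) ≥ 3 * ℓ / 4)).card : ℝ)
      ≤ ∑ J ∈ 𝒥, ((Finset.univ.filter (fun u : Fin (t + 1) → Fin n =>
        IsWalkFun G u ∧ ∀ i, u i ∈ Finset.univ.filter (fun v => blk v ∈ J))).card : ℝ) := by
    exact_mod_cast h1
  refine h2.trans ?_
  have h3 : ∀ J ∈ 𝒥, ((Finset.univ.filter (fun u : Fin (t + 1) → Fin n =>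
        IsWalkFun G u ∧ ∀ i, u i ∈ Finset.univ.filter (fun v => blk v ∈ J))).card : ℝ)
        ≤ n * (31 / 40 * d : ℝ) ^ t := fun J hJ =>
    hG.card_staying_walks_le hβ hd _
      (card_preimage_blocks blk heq J (Finset.mem_filter.1 hJ).2) t
  refine (Finset.sum_le_card_nsmul _ _ _ h3).trans ?_
  rw [nsmul_eq_mul]
  have h4 : (𝒥.card : ℝ) ≤ 2 ^ ℓ := by
    have : 𝒥.card ≤ 2 ^ ℓ := by
      refine (Finset.card_le_univ _).trans ?_
      simp
    exact_mod_cast this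
  gcongr

/-- Union bound over two independent walks. -/
theorem walkPairPr_and_ge {n d : ℕ} (G : SimpleGraph (Fin n)) (hn : 0 < n) (hd : 0 < d)
    (hreg : ∀ v : Fin n, (Finset.univ.filter (fun w => G.Adj v w)).card = d) (t : ℕ)
    (p : (Fin (t + 1) → Fin n) → Prop) {ε : ℝ}
    (hε : ((Finset.univ.filter
      (fun u : Fin (t + 1) → Fin n => IsWalkFun G u ∧ ¬ p u)).card : ℝ) ≤ ε * (n * (d : ℝ) ^ t)) :
    1 - 2 * ε ≤ walkPairPr G d t (fun q₁ q₂ => p q₁ ∧ p q₂) := by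
  have hn' : (0 : ℝ) < n := by exact_mod_cast hn
  have hd' : (0 : ℝ) < d := by exact_mod_cast hd
  set good := Finset.univ.filter (fun u : Fin (t + 1) → Fin n => IsWalkFun G u ∧ p u) with hgood
  have hpr : walkPairPr G d t (fun q₁ q₂ => p q₁ ∧ p q₂)
      = ((good ×ˢ good).card : ℝ) / (n * d ^ t) ^ 2 := by
    unfold walkPairPr
    congr 3
    ext q
    simp only [hgood, Finset.mem_filter, Finset.mem_univ, true_and, Finset.mem_product]
    tauto
  have htot := card_walks G hreg t
  rw [← Finset.card_filter_add_card_filter_not p, Finset.filter_filter, Finset.filter_filter,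
    ← hgood] at htot
  push_cast at htot
  have hN : (0 : ℝ) < n * (d : ℝ) ^ t := by positivity
  rw [hpr, Finset.card_product, le_div_iff₀ (by positivity)]
  push_cast
  set N : ℝ := n * (d : ℝ) ^ t
  set b : ℝ := ((Finset.univ.filter
      (fun u : Fin (t + 1) → Fin n => IsWalkFun G u ∧ ¬ p u)).card : ℝ)
  have hg : (good.card : ℝ) = N - b := by linarith
  rw [hg]
  nlinarith [mul_le_mul_of_nonneg_right hε hN.le, sq_nonneg b]

theorem two_pow_mul_pow_le_exp {L : ℝ} (hL : 100 ≤ L) {t ℓ : ℕ} (ht : L / 4 - 1 ≤ t)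
    (hℓ : (ℓ : ℝ) ≤ L / 100 + 1) :
    2 * (2 ^ ℓ * (31 / 40 : ℝ) ^ t) ≤ Real.exp (-(L / 100)) := by
  have h2 : (2 : ℝ) ≤ Real.exp 1 := by
    have := Real.add_one_le_exp (1 : ℝ); linarith
  have h31 : (31 / 40 : ℝ) ≤ Real.exp (-(9 / 40)) := by
    have := Real.add_one_le_exp (-(9 / 40) : ℝ); linarith
  calc 2 * (2 ^ ℓ * (31 / 40 : ℝ) ^ t)
      ≤ Real.exp 1 * (Real.exp 1 ^ ℓ * Real.exp (-(9 / 40)) ^ t) := by gcongr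
    _ = Real.exp (1 + (ℓ * 1 + t * (-(9 / 40)))) := by
        rw [Real.exp_add, Real.exp_add, Real.exp_nat_mul, Real.exp_nat_mul]
    _ ≤ Real.exp (-(L / 100)) := Real.exp_le_exp.2 (by linarith)

/-- There are constants `γ, κ > 0` and `d₀` such that for every `(n,d,β)`-expander with
`d ≥ d₀` and `β ≤ 1/10`, with `t = ⌊log n/(4·log d)⌋` and `ℓ = ⌈γ·log n/log d⌉`, and any
partition of the vertices into `ℓ` equal-size blocks, two independent `t`-step random
walks each visit at least `3ℓ/4` of the blocks with probability at least
`1 − exp(−κ·log n/log d)`. -/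
theorem two_walks_visit_many_blocks :
    ∃ γ > (0 : ℝ), ∃ κ > (0 : ℝ), ∃ d₀ : ℕ,
      ∀ (n d : ℕ) (β : ℝ) (G : SimpleGraph (Fin n)),
        d ≥ d₀ → β ≤ 1 / 10 → IsExpander n d β G →
        ∀ t ℓ : ℕ,
          t = ⌊Real.log n / (4 * Real.log d)⌋₊ →
          ℓ = ⌈γ * Real.log n / Real.log d⌉₊ →
          ∀ blk : Fin n → Fin ℓ,
            (∀ j j' : Fin ℓ,
              (Finset.univ.filter (fun v => blk v = j)).card =
                (Finset.univ.filter (fun v => blk v = j')).card) →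
            walkPairPr G d t (fun q₁ q₂ =>
                ((Finset.univ.image (fun i => blk (q₁ i))).card : ℝ) ≥ 3 * ℓ / 4 ∧
                ((Finset.univ.image (fun i => blk (q₂ i))).card : ℝ) ≥ 3 * ℓ / 4)
              ≥ 1 - Real.exp (-(κ * Real.log n / Real.log d)) := by
  refine ⟨1 / 100, by norm_num, 1 / 100, by norm_num, 2, ?_⟩
  intro n d β G hd2 hβ hG t ℓ ht hℓ blk heq
  have hd : 0 < d := by omega
  rcases Nat.eq_zero_or_pos n with rfl | hn
  · simp [walkPairPr]
  have hn' : (0 : ℝ) < n := by exact_mod_cast hn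
  have hd' : (0 : ℝ) < d := by exact_mod_cast hd
  set L : ℝ := Real.log n / Real.log d with hLdef
  have hℓ' : ℓ = ⌈L / 100⌉₊ := by rw [hℓ, hLdef]; congr 1; ring
  have ht' : t = ⌊L / 4⌋₊ := by rw [ht, hLdef]; congr 1; rw [div_div, mul_comm]
  have hexp : -(1 / 100 * Real.log n / Real.log d) = -(L / 100) := by rw [hLdef]; ring
  rw [hexp]
  have hL0 : 0 ≤ L := div_nonneg (Real.log_natCast_nonneg n) (Real.log_natCast_nonneg d)
  rcases le_total L 100 with hL | hL
  · have hℓ1 : ℓ ≤ 1 := by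
      rw [hℓ', Nat.ceil_le]; push_cast; linarith
    have hall : ∀ u : Fin (t + 1) → Fin n,
        ((Finset.univ.image (fun i => blk (u i))).card : ℝ) ≥ 3 * ℓ / 4 := by
      intro u
      have h1 : 1 ≤ (Finset.univ.image (fun i => blk (u i))).card :=
        Finset.card_pos.2 (Finset.univ_nonempty.image _)
      have h1' : (1 : ℝ) ≤ (Finset.univ.image (fun i => blk (u i))).card := by exact_mod_cast h1
      have h2 : (ℓ : ℝ) ≤ 1 := by exact_mod_cast hℓ1
      linarith
    have h := walkPairPr_and_ge G hn hd hG.1 t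
      (fun u => ((Finset.univ.image (fun i => blk (u i))).card : ℝ) ≥ 3 * ℓ / 4) (ε := 0)
      (by simp only [hall]; simp)
    have := Real.exp_pos (-(L / 100))
    linarith
  · have hε := hG.card_walks_few_blocks_le hβ hd blk heq t
    have h := walkPairPr_and_ge G hn hd hG.1 t
      (fun u => ((Finset.univ.image (fun i => blk (u i))).card : ℝ) ≥ 3 * ℓ / 4)
      (ε := 2 ^ ℓ * (31 / 40 : ℝ) ^ t) (hε.trans (le_of_eq (by rw [mul_pow]; ring)))
    have hnum := two_pow_mul_pow_le_exp hL (t := t) (ℓ := ℓ)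
      (by rw [ht']; have := Nat.lt_floor_add_one (L / 4); linarith)
      (by rw [hℓ']; exact (Nat.ceil_lt_add_one (by positivity)).le)
    linarith
end

section
/- Let (V,c) be a finite metric space with root r ∈ V and let D be a probability distribution over spanning trees of the complete graph on V such that for every pair of vertices u,v ∈ V, E_{T←D}[c_T(u,v)] ≤ α·c(u,v), where c_T(u,v) is the sum of c over the edges of the unique u–v path in T. Then for every terminal set X ⊆ V, E_{T←D}[c(T[X])] ≤ α·opt_ST(X), where T[X] is the minimal subtree of T containing X ∪ {r} and c(T[X]) is the sum of c over its edges. That is, a tree-embedding distribution with stretch at most α yields an α-approximate universal Steiner tree algorithm. -/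
open scoped Classical

lemma sym2Cost_mk_of_isMetric {V : Type*} {c : V → V → ℝ} (hc : IsMetric c) (u v : V) :
    sym2Cost c s(u, v) = c u v := by
  simp [sym2Cost, hc.symm v u]

lemma IsMetric.nonneg {V : Type*} {c : V → V → ℝ} (hc : IsMetric c) (u v : V) : 0 ≤ c u v := by
  by_cases h : u = v
  · rw [h, hc.refl]
  · exact (hc.pos u v h).le

lemma sym2Cost_nonneg {V : Type*} {c : V → V → ℝ} (hc : IsMetric c) (e : Sym2 V) :
    0 ≤ sym2Cost c e := by
  induction e using Sym2.ind with
  | _ u v => rw [sym2Cost_mk_of_isMetric hc]; exact hc.nonneg u v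

/-- In a forest, the path from `u` to `v` uses only edges of any given walk from `u` to `v`. -/
lemma treePathEdges_subset_walk_edges {V : Type*} [DecidableEq V] {T : SimpleGraph V}
    (hT : T.IsAcyclic) {u v : V} (p : T.Walk u v) :
    treePathEdges T u v ⊆ p.edges.toFinset := by
  have h : T.Reachable u v := ⟨p⟩
  rw [treePathEdges, dif_pos h, (hT.subsingleton_path u v).elim h.some.toPath p.toPath]
  intro e he
  rw [List.mem_toFinset] at he ⊢
  exact p.edges_toPath_subset_edges he

/-- The edges of the tree path from `u` to `v` are the edges of some walk. -/
lemma exists_walk_edges_eq_treePathEdges {V : Type*} [DecidableEq V] {T : SimpleGraph V}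
    {u v : V} (h : T.Reachable u v) :
    ∃ p : T.Walk u v, p.edges.toFinset = treePathEdges T u v :=
  ⟨h.some.toPath.1, by rw [treePathEdges, dif_pos h]⟩

lemma treePathEdges_symm_subset {V : Type*} [DecidableEq V] {T : SimpleGraph V}
    (hT : T.IsTree) (u v : V) : treePathEdges T u v ⊆ treePathEdges T v u := by
  obtain ⟨p, hp⟩ := exists_walk_edges_eq_treePathEdges (hT.connected.preconnected v u)
  have h := treePathEdges_subset_walk_edges hT.isAcyclic p.reverse
  rwa [SimpleGraph.Walk.edges_reverse, List.toFinset_reverse, hp] at h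

lemma treePathEdges_self {V : Type*} [DecidableEq V] {T : SimpleGraph V}
    (hT : T.IsTree) (u : V) : treePathEdges T u u = ∅ := by
  have h := treePathEdges_subset_walk_edges hT.isAcyclic (SimpleGraph.Walk.nil : T.Walk u u)
  simpa using h

lemma treePathEdges_subset_union {V : Type*} [DecidableEq V] {T : SimpleGraph V}
    (hT : T.IsTree) (u v w : V) :
    treePathEdges T u w ⊆ treePathEdges T u v ∪ treePathEdges T v w := by
  obtain ⟨p, hp⟩ := exists_walk_edges_eq_treePathEdges (hT.connected.preconnected u v)
  obtain ⟨q, hq⟩ := exists_walk_edges_eq_treePathEdges (hT.connected.preconnected v w)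
  have h := treePathEdges_subset_walk_edges hT.isAcyclic (p.append q)
  rwa [SimpleGraph.Walk.edges_append, List.toFinset_append, hp, hq] at h

lemma treePathEdges_subset_out {V : Type*} [DecidableEq V] {T : SimpleGraph V}
    (hT : T.IsTree) (u v : V) :
    treePathEdges T u v ⊆
      treePathEdges T (Quot.out s(u, v)).1 (Quot.out s(u, v)).2 := by
  have h : s((Quot.out s(u, v)).1, (Quot.out s(u, v)).2) = s(u, v) := Quot.out_eq s(u, v)
  rcases Sym2.eq_iff.1 h with ⟨h₁, h₂⟩ | ⟨h₁, h₂⟩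
  · rw [h₁, h₂]
  · rw [h₁, h₂]
    exact treePathEdges_symm_subset hT u v

/-- The path in the tree `T` between the endpoints of a walk in another graph `S` is covered by
the `T`-paths joining the endpoints of the edges of `S`. -/
lemma treePathEdges_subset_biUnion {V : Type*} [Fintype V] [DecidableEq V]
    {T S : SimpleGraph V} (hT : T.IsTree) {u v : V} (p : S.Walk u v) :
    treePathEdges T u v ⊆
      (Finset.univ.filter (fun e : Sym2 V => e ∈ S.edgeSet)).biUnion
        (fun e => treePathEdges T (Quot.out e).1 (Quot.out e).2) := by
  induction p with
  | nil => simp [treePathEdges_self hT]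
  | @cons a b d hab p ih =>
    refine (treePathEdges_subset_union hT a b d).trans (Finset.union_subset ?_ ih)
    refine (treePathEdges_subset_out hT a b).trans ?_
    exact Finset.subset_biUnion_of_mem
      (fun e : Sym2 V => treePathEdges T (Quot.out e).1 (Quot.out e).2)
      (by simpa using hab)

lemma sum_biUnion_le_sum_sum {ι β : Type*} [DecidableEq β] (s : Finset ι) (t : ι → Finset β)
    {f : β → ℝ} (hf : ∀ b, 0 ≤ f b) :
    ∑ b ∈ s.biUnion t, f b ≤ ∑ i ∈ s, ∑ b ∈ t i, f b := by
  classical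
  induction s using Finset.induction_on with
  | empty => simp
  | insert i s hi ih =>
    rw [Finset.biUnion_insert, Finset.sum_insert hi]
    have h := Finset.sum_union_inter (s₁ := t i) (s₂ := s.biUnion t) (f := f)
    have h' := Finset.sum_nonneg (s := t i ∩ s.biUnion t) (fun b _ => hf b)
    linarith

lemma subtreeCost_le_sum_treePathCost {V : Type*} [Fintype V] [DecidableEq V]
    {c : V → V → ℝ} (hc : IsMetric c) {T S : SimpleGraph V} (hT : T.IsTree) {r : V}
    {X : Finset V} (hS : ∀ v ∈ insert r X, S.Reachable v r) :
    subtreeCost c T r X ≤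
      ∑ e ∈ Finset.univ.filter (fun e : Sym2 V => e ∈ S.edgeSet),
        treePathCost c T (Quot.out e).1 (Quot.out e).2 := by
  refine le_trans (Finset.sum_le_sum_of_subset_of_nonneg ?_ fun e _ _ => sym2Cost_nonneg hc e)
    (sum_biUnion_le_sum_sum _ _ (sym2Cost_nonneg hc))
  exact Finset.biUnion_subset.2 fun v hv =>
    treePathEdges_subset_biUnion hT (hS v hv).some

lemma steinerCosts_finite {V : Type*} [Fintype V] [DecidableEq V] (c : V → V → ℝ) (r : V)
    (X : Finset V) : (steinerCosts c r X).Finite := by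
  refine (Set.finite_range fun T : SimpleGraph V =>
    ∑ e ∈ Finset.univ.filter (fun e : Sym2 V => e ∈ T.edgeSet), sym2Cost c e).subset ?_
  rintro y ⟨W, T, -, -, -, rfl⟩
  exact ⟨T, rfl⟩

lemma steinerCosts_nonempty {V : Type*} [Fintype V] [DecidableEq V] (c : V → V → ℝ) (r : V)
    (X : Finset V) {T : SimpleGraph V} (hT : T.IsTree) : (steinerCosts c r X).Nonempty := by
  refine ⟨_, Finset.univ, T, Finset.subset_univ _, fun _ _ _ _ => Finset.mem_univ _, ?_, rfl⟩
  rw [Finset.coe_univ]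
  exact (SimpleGraph.induceUnivIso T).isTree_iff.2 hT

lemma FinDist.support_nonempty {A : Type*} (D : FinDist A) : D.support.Nonempty := by
  by_contra h
  have h' : D.w.support = ∅ := Finset.not_nonempty_iff_eq_empty.1 h
  have := D.total
  rw [h'] at this
  simp at this

lemma FinDist.exp_mono {A : Type*} (D : FinDist A) {f g : A → ℝ}
    (h : ∀ a ∈ D.support, f a ≤ g a) : D.exp f ≤ D.exp g :=
  Finset.sum_le_sum fun a ha => mul_le_mul_of_nonneg_left (h a ha) (D.nonneg a)

lemma FinDist.exp_sum {A ι : Type*} (D : FinDist A) (s : Finset ι) (f : ι → A → ℝ) :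
    D.exp (fun a => ∑ i ∈ s, f i a) = ∑ i ∈ s, D.exp (f i) := by
  simp only [FinDist.exp, Finset.mul_sum]
  exact Finset.sum_comm

/-- A tree-embedding distribution with stretch at most `α` yields an `α`-approximate
universal Steiner tree algorithm: if `D` is a distribution over spanning trees of the
metric space `(V,c)` such that `E_{T←D}[c_T(u,v)] ≤ α·c(u,v)` for every pair `u,v`, then
for every terminal set `X`, `E_{T←D}[c(T[X])] ≤ α·opt_ST(X)`. -/
theorem stretch_gives_universal_steiner {V : Type*} [Fintype V] [DecidableEq V]
    (c : V → V → ℝ) (hc : IsMetric c) (r : V) (α : ℝ)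
    (D : FinDist (SimpleGraph V))
    (htree : ∀ T ∈ D.support, T.IsTree)
    (hstretch : ∀ u v : V, D.exp (fun T => treePathCost c T u v) ≤ α * c u v) :
    ∀ X : Finset V, D.exp (fun T => subtreeCost c T r X) ≤ α * optST c r X := by
  intro X
  obtain ⟨T₀, hT₀⟩ := D.support_nonempty
  obtain ⟨W, S, hW, -, hS, hy⟩ : optST c r X ∈ steinerCosts c r X :=
    (steinerCosts_nonempty c r X (htree T₀ hT₀)).csInf_mem (steinerCosts_finite c r X)
  have hreach : ∀ v ∈ insert r X, S.Reachable v r := fun v hv =>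
    (hS.connected.preconnected ⟨v, hW hv⟩ ⟨r, hW (Finset.mem_insert_self r X)⟩).map
      (SimpleGraph.Embedding.induce _).toHom
  rw [hy, Finset.mul_sum]
  refine (D.exp_mono fun T hT => subtreeCost_le_sum_treePathCost hc (htree T hT) hreach).trans ?_
  rw [FinDist.exp_sum D _ fun (e : Sym2 V) T => treePathCost c T (Quot.out e).1 (Quot.out e).2]
  refine Finset.sum_le_sum fun e _ => (hstretch _ _).trans_eq ?_
  rw [← sym2Cost_mk_of_isMetric hc]
  exact congrArg (fun e => α * sym2Cost c e) (Quot.out_eq e)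
end
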